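/- Explicit solution of the limiting equation: let t_f > 0, let μᵗ be a finite Borel measure on [0,t_f] absolutely continuous with respect to Lebesgue measure, let m > 0, and set F(t) = μᵗ([0,t]). Then the function β_t = 1 − e^{−m·F(t)} takes values in [0,1], is nondecreasing with β_0 = 0, and satisfies β_t = m ∫_{[0,t]} (1 − β_s) μᵗ(ds) for every t ∈ [0,t_f]. Equivalently, with V = [0,t_f] × [0,1] × W, μ_T = μᵗ ⊗ Leb_{[0,1]} ⊗ μˢ and m = μˢ(W), β is a fixed point of the operator 𝒯_{μ_T} given by 𝒯_ν(β)_t = ν({(s,u,x) ∈ V : s ≤ t and β_s ≤ u}). -/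

import Mathlib

open MeasureTheory Set Filter
open scoped ENNReal NNReal Topology

noncomputable section

/-- Ambient space `ℝ × ℝ × ℝ^d` hosting `V = [0,t_f] × [0,1] × W`. -/
abbrev SpacePt (d : ℕ) := ℝ × ℝ × (Fin d → ℝ)

/-- The intensity measure `μ_T = μᵗ ⊗ Leb_{[0,1]} ⊗ μˢ`. -/
noncomputable def muT (d : ℕ) (μt : Measure ℝ) (μs : Measure (Fin d → ℝ)) :
    Measure (SpacePt d) :=
  μt.prod ((volume.restrict (Icc (0:ℝ) 1)).prod μs)

/-- The explicit solution `β_t = 1 − e^{−m·F(t)}` with `F(t) = μᵗ([0,t])`. -/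
noncomputable def betaExp (μt : Measure ℝ) (m t : ℝ) : ℝ :=
  1 - Real.exp (-(m * (μt (Icc (0:ℝ) t)).toReal))

lemma F_cont (μ : Measure ℝ) [IsFiniteMeasure μ] [NullSingletonClass μ] :
    ContinuousOn (fun s => μ.real (Icc (0:ℝ) s)) (Ici 0) := by
  have h : Continuous fun b => ∫ x in (0:ℝ)..b, (1:ℝ) ∂μ :=
    intervalIntegral.continuous_primitive (fun a b => by simp) 0
  refine h.continuousOn.congr ?_
  intro s hs
  have hs' : (0:ℝ) ≤ s := hs
  simp only [intervalIntegral.integral_of_le hs', integral_const, smul_eq_mul, mul_one]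
  rw [measureReal_restrict_apply_univ]
  exact measureReal_congr Ioc_ae_eq_Icc.symm

lemma F_mono (μ : Measure ℝ) [IsFiniteMeasure μ] :
    Monotone (fun s => μ.real (Icc (0:ℝ) s)) := by
  intro a b hab
  exact measureReal_mono (Icc_subset_Icc_right hab)

lemma F_map (μ : Measure ℝ) [IsFiniteMeasure μ] [NullSingletonClass μ] (t : ℝ) (ht : 0 ≤ t) :
    (μ.restrict (Icc 0 t)).map (fun s => μ.real (Icc (0:ℝ) s)) =
      volume.restrict (Icc 0 (μ.real (Icc (0:ℝ) t))) := by
  have hmono := F_mono μ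
  have hcont := F_cont μ
  set F : ℝ → ℝ := fun s => μ.real (Icc (0:ℝ) s) with hF
  have hF0 : F 0 = 0 := by simp [hF, measureReal_def]
  have hFnn : ∀ s, 0 ≤ F s := fun s => measureReal_nonneg
  have hofF : ∀ s, μ (Icc (0:ℝ) s) = ENNReal.ofReal (F s) := fun s => by
    simp [hF]
  refine Measure.ext_of_Iic _ _ fun a => ?_
  rw [Measure.map_apply hmono.measurable measurableSet_Iic,
    Measure.restrict_apply (hmono.measurable measurableSet_Iic),
    Measure.restrict_apply measurableSet_Iic]
  change μ (F ⁻¹' Iic a ∩ Icc 0 t) = volume (Iic a ∩ Icc 0 (F t))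
  rcases lt_or_ge a 0 with ha | ha
  · have h1 : F ⁻¹' Iic a ∩ Icc 0 t = ∅ := by
      ext s
      have := hFnn s
      simp only [mem_inter_iff, mem_preimage, mem_Iic, mem_empty_iff_false, iff_false]
      rintro ⟨h, -⟩
      linarith
    have h2 : Iic a ∩ Icc 0 (F t) = ∅ := by
      ext s
      simp only [mem_inter_iff, mem_Icc, mem_Iic, mem_empty_iff_false, iff_false]
      rintro ⟨h, h', -⟩
      linarith
    rw [h1, h2]; simp
  rcases le_or_gt (F t) a with hat | hat
  · have h1 : F ⁻¹' Iic a ∩ Icc 0 t = Icc 0 t := by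
      refine inter_eq_right.2 fun s hs => ?_
      exact (hmono hs.2).trans hat
    have h2 : Iic a ∩ Icc 0 (F t) = Icc 0 (F t) :=
      inter_eq_right.2 fun s hs => hs.2.trans hat
    rw [h1, h2, Real.volume_Icc, sub_zero, hofF]
  · have hc : ContinuousOn F (Icc 0 t) := hcont.mono Icc_subset_Ici_self
    have hcomp : IsCompact (Icc 0 t ∩ F ⁻¹' Iic a) :=
      isCompact_Icc.of_isClosed_subset
        (hc.preimage_isClosed_of_isClosed isClosed_Icc isClosed_Iic) inter_subset_left
    have hne : (Icc 0 t ∩ F ⁻¹' Iic a).Nonempty :=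
      ⟨0, ⟨le_rfl, ht⟩, by simpa [hF0] using ha⟩
    obtain ⟨s0, hs0, hmax⟩ := hcomp.exists_isGreatest hne
    have h1 : F ⁻¹' Iic a ∩ Icc 0 t = Icc 0 s0 := by
      ext s
      constructor
      · rintro ⟨h, h'⟩
        exact ⟨h'.1, hmax ⟨h', h⟩⟩
      · rintro ⟨h, h'⟩
        exact ⟨(hmono h').trans hs0.2, h, h'.trans hs0.1.2⟩
    have h2 : Iic a ∩ Icc 0 (F t) = Icc 0 a := by
      ext s
      constructor
      · rintro ⟨h, h'⟩
        exact ⟨h'.1, h⟩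
      · rintro ⟨h, h'⟩
        exact ⟨h', h, h'.trans hat.le⟩
    have h3 : F s0 = a := by
      obtain ⟨s1, hs1, he⟩ := intermediate_value_Icc hs0.1.2
        (hc.mono (Icc_subset_Icc_left hs0.1.1)) ⟨hs0.2, hat.le⟩
      have : s1 ≤ s0 := hmax ⟨⟨hs0.1.1.trans hs1.1, hs1.2⟩, he.le⟩
      have : s1 = s0 := le_antisymm this hs1.1
      rw [← this, he]
    rw [h1, h2, Real.volume_Icc, sub_zero, hofF, h3]

lemma beta_eq (μ : Measure ℝ) [IsFiniteMeasure μ] [NullSingletonClass μ] (m : ℝ) (hm : 0 < m)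
    (t : ℝ) (ht : 0 ≤ t) :
    betaExp μ m t = m * ∫ s in Icc (0:ℝ) t, (1 - betaExp μ m s) ∂μ := by
  have hmap := F_map μ t ht
  have hc : Continuous fun u : ℝ => Real.exp (-(m * u)) := by fun_prop
  have h1 : ∫ s in Icc (0:ℝ) t, (1 - betaExp μ m s) ∂μ =
      ∫ u in Icc 0 (μ.real (Icc (0:ℝ) t)), Real.exp (-(m * u)) := by
    rw [← hmap, integral_map (F_mono μ).measurable.aemeasurable hc.aestronglyMeasurable]
    simp [betaExp, measureReal_def]
  have hd : ∀ x ∈ uIcc 0 (μ.real (Icc (0:ℝ) t)),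
      HasDerivAt (fun u : ℝ => -(Real.exp (-(m * u)) / m)) (Real.exp (-(m * x))) x := by
    intro x _
    have h0 : HasDerivAt (fun u : ℝ => -(m * u)) (-(m * 1)) x :=
      ((hasDerivAt_id' x).const_mul m).fun_neg
    have h2 : HasDerivAt (fun u : ℝ => -(Real.exp (-(m * u)) / m))
        (-(Real.exp (-(m * x)) * (-(m * 1)) / m)) x := (h0.exp.div_const m).fun_neg
    have h3 : -(Real.exp (-(m * x)) * (-(m * 1)) / m) = Real.exp (-(m * x)) := by
      field_simp
    rwa [h3] at h2
  rw [h1, integral_Icc_eq_integral_Ioc, ← intervalIntegral.integral_of_le measureReal_nonneg,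
    intervalIntegral.integral_eq_sub_of_hasDerivAt hd (hc.intervalIntegrable _ _)]
  simp only [betaExp, measureReal_def, mul_zero, neg_zero, Real.exp_zero]
  field_simp
  ring

lemma beta_mono (μ : Measure ℝ) [IsFiniteMeasure μ] (m : ℝ) (hm : 0 < m) :
    Monotone (betaExp μ m) := by
  intro a b hab
  have h : μ.real (Icc (0:ℝ) a) ≤ μ.real (Icc (0:ℝ) b) := F_mono μ hab
  have h2 := mul_le_mul_of_nonneg_left h hm.le
  have h3 := Real.exp_le_exp.2 (neg_le_neg h2)
  simp only [betaExp, measureReal_def] at *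
  linarith

lemma beta_mem (μ : Measure ℝ) (m : ℝ) (hm : 0 < m) (t : ℝ) :
    betaExp μ m t ∈ Icc (0:ℝ) 1 := by
  have h : 0 ≤ m * (μ (Icc (0:ℝ) t)).toReal := by positivity
  have h1 := Real.exp_le_one_iff.2 (neg_nonpos.2 h)
  have h2 := Real.exp_pos (-(m * (μ (Icc (0:ℝ) t)).toReal))
  simp only [betaExp, mem_Icc]
  constructor <;> linarith

/-- The function `β_t = 1 − e^{−m·F(t)}` takes values in `[0,1]`, is
nondecreasing with `β_0 = 0`, solves `β_t = m ∫_{[0,t]} (1 − β_s) μᵗ(ds)`, and, for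
`m = μˢ(W)`, is a fixed point of the operator `𝒯_{μ_T}`. -/
theorem statement19 (tf : ℝ) (htf : 0 < tf)
    (μt : Measure ℝ) [IsFiniteMeasure μt] (hμt_ac : μt ≪ (volume : Measure ℝ))
    (hμt_supp : μt (Icc (0:ℝ) tf)ᶜ = 0)
    (m : ℝ) (hm : 0 < m)
    (d : ℕ) (W : Set (Fin d → ℝ)) (hW : IsCompact W)
    (μs : Measure (Fin d → ℝ)) [IsFiniteMeasure μs] (hμs_supp : μs Wᶜ = 0) :
    (∀ t ∈ Icc (0:ℝ) tf, betaExp μt m t ∈ Icc (0:ℝ) 1) ∧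
    MonotoneOn (betaExp μt m) (Icc (0:ℝ) tf) ∧
    betaExp μt m 0 = 0 ∧
    (∀ t ∈ Icc (0:ℝ) tf,
      betaExp μt m t = m * ∫ s in Icc (0:ℝ) t, (1 - betaExp μt m s) ∂μt) ∧
    (m = (μs W).toReal →
      ∀ t ∈ Icc (0:ℝ) tf,
        ENNReal.ofReal (betaExp μt m t) =
          muT d μt μs {p : SpacePt d | p.1 ∈ Icc (0:ℝ) tf ∧ p.2.1 ∈ Icc (0:ℝ) 1 ∧
            p.2.2 ∈ W ∧ p.1 ≤ t ∧ betaExp μt m p.1 ≤ p.2.1}) := by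
  have : NullSingletonClass μt := ⟨fun x => hμt_ac (by simp)⟩
  refine ⟨fun t _ => beta_mem μt m hm t, (beta_mono μt m hm).monotoneOn _, ?_,
    fun t ht => beta_eq μt m hm t ht.1, ?_⟩
  · simp [betaExp]
  intro hmW t ht
  have hβ := (beta_mono μt m hm).measurable
  have hWm : MeasurableSet W := hW.measurableSet
  have hmeas : MeasurableSet {p : SpacePt d | p.1 ∈ Icc (0:ℝ) tf ∧ p.2.1 ∈ Icc (0:ℝ) 1 ∧
            p.2.2 ∈ W ∧ p.1 ≤ t ∧ betaExp μt m p.1 ≤ p.2.1} := by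
    refine (measurable_fst measurableSet_Icc).inter ?_
    refine ((measurable_fst.comp measurable_snd) measurableSet_Icc).inter ?_
    refine ((measurable_snd.comp measurable_snd) hWm).inter ?_
    refine (measurableSet_le measurable_fst measurable_const).inter ?_
    exact measurableSet_le (hβ.comp measurable_fst) (measurable_fst.comp measurable_snd)
  rw [muT, Measure.prod_apply hmeas]
  have hslice : ∀ s : ℝ, ((volume.restrict (Icc (0:ℝ) 1)).prod μs)
      (Prod.mk s ⁻¹' {p : SpacePt d | p.1 ∈ Icc (0:ℝ) tf ∧ p.2.1 ∈ Icc (0:ℝ) 1 ∧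
            p.2.2 ∈ W ∧ p.1 ≤ t ∧ betaExp μt m p.1 ≤ p.2.1}) =
      (Icc (0:ℝ) t).indicator (fun s => ENNReal.ofReal (m * (1 - betaExp μt m s))) s := by
    intro s
    by_cases hs : s ∈ Icc (0:ℝ) t
    · rw [indicator_of_mem hs]
      have hb := beta_mem μt m hm s
      have : (Prod.mk s ⁻¹' {p : SpacePt d | p.1 ∈ Icc (0:ℝ) tf ∧ p.2.1 ∈ Icc (0:ℝ) 1 ∧
            p.2.2 ∈ W ∧ p.1 ≤ t ∧ betaExp μt m p.1 ≤ p.2.1}) =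
            Icc (betaExp μt m s) 1 ×ˢ W := by
        ext ⟨u, x⟩
        simp only [mem_preimage, mem_ofPred_eq, mem_prod, mem_Icc]
        constructor
        · rintro ⟨-, ⟨-, h1⟩, h2, -, h3⟩
          exact ⟨⟨h3, h1⟩, h2⟩
        · rintro ⟨⟨h3, h1⟩, h2⟩
          exact ⟨⟨hs.1, hs.2.trans ht.2⟩, ⟨hb.1.trans h3, h1⟩, h2, hs.2, h3⟩
      rw [this, Measure.prod_prod, Measure.restrict_apply measurableSet_Icc,
        inter_eq_left.2 (Icc_subset_Icc_left hb.1), Real.volume_Icc,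
        ENNReal.ofReal_mul hm.le, mul_comm]
      congr 1
      rw [hmW, ENNReal.ofReal_toReal (measure_ne_top _ _)]
    · rw [indicator_of_notMem hs]
      refine measure_mono_null (t := ∅) (Eq.subset ?_) measure_empty
      ext ⟨u, x⟩
      simp only [mem_preimage, mem_ofPred_eq, mem_empty_iff_false, iff_false]
      rintro ⟨h1, -, -, h2, -⟩
      exact hs ⟨h1.1, h2⟩
  simp_rw [hslice]
  rw [lintegral_indicator measurableSet_Icc, beta_eq μt m hm t ht.1, ← integral_const_mul]
  have hnn : ∀ s, 0 ≤ m * (1 - betaExp μt m s) := fun s =>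
    mul_nonneg hm.le (sub_nonneg.2 (beta_mem μt m hm s).2)
  refine ofReal_integral_eq_lintegral_ofReal ?_ (Eventually.of_forall hnn)
  refine Integrable.const_mul ?_ m
  refine Integrable.of_bound (C := 1) (measurable_const.sub hβ).aestronglyMeasurable
    (Eventually.of_forall fun s => ?_)
  have hb := beta_mem μt m hm s
  rw [Real.norm_eq_abs, abs_le]
  constructor <;> linarith [hb.1, hb.2]

end
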